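/- Let J be a B(H)-ideal and let 𝒮 = {S₁, …, S_N} ⊆ J be a finite set. The following are equivalent: (a) (𝒮)_J is a B(H)-ideal; (b) ⟨𝒮⟩_J is a B(H)-ideal; (c) (𝒮)_J^ℝ is a B(H)-ideal; (d) (𝒮) = J(𝒮), i.e., (𝒮) is J-soft; (e) for every 1 ≤ j ≤ N, S_j is a finite sum of operators of the form A S_k B with A, B ∈ J and 1 ≤ k ≤ N. Moreover, when these hold, ⟨𝒮⟩_J = (𝒮)_J^ℝ = (𝒮)_J = (𝒮). -/

import Mathlib

open scoped BigOperators
open TopologicalSpace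

variable {H : Type*} [NormedAddCommGroup H] [InnerProductSpace ℂ H] [CompleteSpace H]

/-- `J` is a two-sided ideal of `B(H)`: an additive subgroup closed under left and
right multiplication by arbitrary bounded operators. -/
def IsBHIdeal (J : Set (H →L[ℂ] H)) : Prop :=
  (0 : H →L[ℂ] H) ∈ J ∧
  (∀ x ∈ J, ∀ y ∈ J, x + y ∈ J) ∧
  (∀ x ∈ J, -x ∈ J) ∧
  ∀ (A : H →L[ℂ] H), ∀ x ∈ J, A * x ∈ J ∧ x * A ∈ J

/-- `I` is a `J`-ideal: an additive subgroup of `B(H)` contained in `J` and closed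
under left and right multiplication by elements of `J`. -/
def IsSubideal (J I : Set (H →L[ℂ] H)) : Prop :=
  I ⊆ J ∧ (0 : H →L[ℂ] H) ∈ I ∧
  (∀ x ∈ I, ∀ y ∈ I, x + y ∈ I) ∧
  (∀ x ∈ I, -x ∈ I) ∧
  ∀ A ∈ J, ∀ x ∈ I, A * x ∈ I ∧ x * A ∈ I

/-- A linear `J`-ideal: a `J`-ideal closed under multiplication by complex scalars. -/
def IsLinearSubideal (J I : Set (H →L[ℂ] H)) : Prop :=
  IsSubideal J I ∧ ∀ (c : ℂ), ∀ x ∈ I, c • x ∈ I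

/-- A real linear `J`-ideal: a `J`-ideal closed under multiplication by real scalars. -/
def IsRealSubideal (J I : Set (H →L[ℂ] H)) : Prop :=
  IsSubideal J I ∧ ∀ (r : ℝ), ∀ x ∈ I, r • x ∈ I

/-- `(𝒮)`: the smallest two-sided ideal of `B(H)` containing `𝒮`. -/
def genBH (𝒮 : Set (H →L[ℂ] H)) : Set (H →L[ℂ] H) :=
  ⋂₀ {I | IsBHIdeal I ∧ 𝒮 ⊆ I}

/-- `⟨𝒮⟩_J`: the smallest `J`-ideal containing `𝒮`. -/
def genSub (J 𝒮 : Set (H →L[ℂ] H)) : Set (H →L[ℂ] H) :=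
  ⋂₀ {I | IsSubideal J I ∧ 𝒮 ⊆ I}

/-- `(𝒮)_J`: the smallest linear `J`-ideal containing `𝒮`. -/
def genLin (J 𝒮 : Set (H →L[ℂ] H)) : Set (H →L[ℂ] H) :=
  ⋂₀ {I | IsLinearSubideal J I ∧ 𝒮 ⊆ I}

/-- `(𝒮)_J^ℝ`: the smallest real linear `J`-ideal containing `𝒮`. -/
def genReal (J 𝒮 : Set (H →L[ℂ] H)) : Set (H →L[ℂ] H) :=
  ⋂₀ {I | IsRealSubideal J I ∧ 𝒮 ⊆ I}

/-- `J(𝒮)`: all finite sums `Σ Aᵢ Xᵢ` with `Aᵢ ∈ J` and `Xᵢ ∈ (𝒮)`. -/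
def JGen (J 𝒮 : Set (H →L[ℂ] H)) : Set (H →L[ℂ] H) :=
  {T | ∃ (n : ℕ) (A X : Fin n → (H →L[ℂ] H)),
    (∀ i, A i ∈ J ∧ X i ∈ genBH 𝒮) ∧ T = ∑ i, A i * X i}

/-- `J(𝒮)J`: all finite sums `Σ Aᵢ Xᵢ Bᵢ` with `Aᵢ, Bᵢ ∈ J` and `Xᵢ ∈ (𝒮)`. -/
def JGenJ (J 𝒮 : Set (H →L[ℂ] H)) : Set (H →L[ℂ] H) :=
  {T | ∃ (n : ℕ) (A X B : Fin n → (H →L[ℂ] H)),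
    (∀ i, A i ∈ J ∧ X i ∈ genBH 𝒮 ∧ B i ∈ J) ∧ T = ∑ i, A i * X i * B i}

/-- `JS + SJ + J(S)J = {AS + SB + Y : A, B ∈ J, Y ∈ J(S)J}`. -/
def JSplus (J : Set (H →L[ℂ] H)) (S : H →L[ℂ] H) : Set (H →L[ℂ] H) :=
  {T | ∃ A ∈ J, ∃ B ∈ J, ∃ Y ∈ JGenJ J {S}, T = A * S + S * B + Y}

/-- `K(H)`: the compact operators on `H`. -/
def KH : Set (H →L[ℂ] H) := {T | IsCompactOperator ⇑T}

/-- `T` is a finite-rank operator: its range is finite-dimensional. -/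
def IsFiniteRank (T : H →L[ℂ] H) : Prop :=
  FiniteDimensional ℂ (LinearMap.range (T : H →ₗ[ℂ] H))

set_option linter.unusedSectionVars false

namespace IsBHIdeal

/-- The complex subspace underlying a `B(H)`-ideal. -/
def toSubmodule {J : Set (H →L[ℂ] H)} (hJ : IsBHIdeal J) : Submodule ℂ (H →L[ℂ] H) where
  carrier := J
  add_mem' {x y} hx hy := hJ.2.1 x hx y hy
  zero_mem' := hJ.1
  smul_mem' c x hx := by simpa using (hJ.2.2.2 (c • 1) x hx).1

theorem mul_left {J : Set (H →L[ℂ] H)} (hJ : IsBHIdeal J) (A : H →L[ℂ] H) {x : H →L[ℂ] H}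
    (hx : x ∈ J) : A * x ∈ J :=
  (hJ.2.2.2 A x hx).1

theorem mul_right {J : Set (H →L[ℂ] H)} (hJ : IsBHIdeal J) (A : H →L[ℂ] H) {x : H →L[ℂ] H}
    (hx : x ∈ J) : x * A ∈ J :=
  (hJ.2.2.2 A x hx).2

theorem of_submodule {M : Submodule ℂ (H →L[ℂ] H)}
    (hM : ∀ A, ∀ x ∈ M, A * x ∈ M ∧ x * A ∈ M) : IsBHIdeal (M : Set (H →L[ℂ] H)) :=
  ⟨M.zero_mem, fun _ hx _ hy => M.add_mem hx hy, fun _ hx => M.neg_mem hx, hM⟩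

theorem mul {M N : Submodule ℂ (H →L[ℂ] H)} (hM : IsBHIdeal (M : Set (H →L[ℂ] H)))
    (hN : IsBHIdeal (N : Set (H →L[ℂ] H))) :
    IsBHIdeal ((M * N : Submodule ℂ (H →L[ℂ] H)) : Set (H →L[ℂ] H)) := by
  refine of_submodule fun A x hx => ?_
  induction hx using Submodule.mul_induction_on' with
  | mem_mul_mem m hm n hn =>
    refine ⟨?_, ?_⟩
    · rw [← mul_assoc]
      exact Submodule.mul_mem_mul (hM.mul_left A hm) hn
    · rw [mul_assoc]
      exact Submodule.mul_mem_mul hm (hN.mul_right A hn)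
  | add x _ y _ hx hy =>
    rw [mul_add, add_mul]
    exact ⟨add_mem hx.1 hy.1, add_mem hx.2 hy.2⟩

theorem sup {M N : Submodule ℂ (H →L[ℂ] H)} (hM : IsBHIdeal (M : Set (H →L[ℂ] H)))
    (hN : IsBHIdeal (N : Set (H →L[ℂ] H))) :
    IsBHIdeal ((M ⊔ N : Submodule ℂ (H →L[ℂ] H)) : Set (H →L[ℂ] H)) := by
  refine of_submodule fun A x hx => ?_
  obtain ⟨m, hm, n, hn, rfl⟩ := Submodule.mem_sup.1 hx
  rw [mul_add, add_mul]
  exact ⟨Submodule.add_mem_sup (hM.mul_left A hm) (hN.mul_left A hn),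
    Submodule.add_mem_sup (hM.mul_right A hm) (hN.mul_right A hn)⟩

end IsBHIdeal

/-- Douglas' factorization: an operator dominated by `B` factors through `B`. -/
theorem exists_mul_eq_of_norm_le {A B : H →L[ℂ] H} (h : ∀ x, ‖A x‖ ≤ ‖B x‖) :
    ∃ C : H →L[ℂ] H, A = C * B := by
  let K : Submodule ℂ H := (LinearMap.range (B : H →ₗ[ℂ] H)).topologicalClosure
  have hBK (x : H) : B x ∈ K := Submodule.le_topologicalClosure _ ⟨x, rfl⟩
  let e : H →ₗ[ℂ] K := (B : H →ₗ[ℂ] H).codRestrict K hBK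
  have hK : IsClosed (K : Set H) := Submodule.isClosed_topologicalClosure _
  have : CompleteSpace K := hK.completeSpace_coe
  have he : DenseRange e := by
    rw [DenseRange, Subtype.dense_iff]
    intro x hx
    refine closure_mono ?_ hx
    rintro _ ⟨z, rfl⟩
    exact ⟨e z, ⟨z, rfl⟩, rfl⟩
  refine ⟨(A : H →ₗ[ℂ] H).extendOfNorm e ∘L K.orthogonalProjectionOnto, ?_⟩
  ext x
  have hx : K.orthogonalProjectionOnto (B x) = e x :=
    K.orthogonalProjectionOnto_mem_subspace_eq_self ⟨B x, hBK x⟩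
  have := LinearMap.extendOfNorm_eq (f := (A : H →ₗ[ℂ] H)) he
    ⟨1, fun x => by simpa [e] using h x⟩ x
  simp [hx, this]

/-- The polar decomposition yields that the adjoint of `T` factors through `T`. -/
theorem exists_star_eq_mul_mul (T : H →L[ℂ] H) : ∃ C D : H →L[ℂ] H, star T = C * T * D := by
  have hsa : star (CFC.abs T) = CFC.abs T := (CFC.abs_nonneg T).star_eq
  have hnorm (x : H) : ‖CFC.abs T x‖ = ‖T x‖ := by
    have h := congrArg (fun S : H →L[ℂ] H => inner ℂ (S x) x) (CFC.abs_mul_abs T)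
    nth_rewrite 1 [← hsa] at h
    simp only [mul_apply_eq_comp, ContinuousLinearMap.star_eq_adjoint,
      ContinuousLinearMap.adjoint_inner_left, inner_self_eq_norm_sq_to_K] at h
    have h' : ‖CFC.abs T x‖ ^ 2 = ‖T x‖ ^ 2 := by exact_mod_cast h
    exact (sq_eq_sq₀ (norm_nonneg _) (norm_nonneg _)).1 h'
  obtain ⟨U, hU⟩ := exists_mul_eq_of_norm_le fun x => (hnorm x).ge
  obtain ⟨W, hW⟩ := exists_mul_eq_of_norm_le fun x => (hnorm x).le
  refine ⟨W, star U, ?_⟩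
  rw [← hW, ← hsa, ← star_mul, ← hU]

theorem IsBHIdeal.star_mem {J : Set (H →L[ℂ] H)} (hJ : IsBHIdeal J) {T : H →L[ℂ] H}
    (hT : T ∈ J) : star T ∈ J := by
  obtain ⟨C, D, h⟩ := exists_star_eq_mul_mul T
  rw [h]
  exact hJ.mul_right D (hJ.mul_left C hT)

theorem IsBHIdeal.mul_le_mul_swap {M N : Submodule ℂ (H →L[ℂ] H)}
    (hM : IsBHIdeal (M : Set (H →L[ℂ] H))) (hN : IsBHIdeal (N : Set (H →L[ℂ] H))) :
    M * N ≤ N * M := by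
  have key : ∀ T ∈ M * N, star T ∈ N * M := by
    intro T hT
    induction hT using Submodule.mul_induction_on' with
    | mem_mul_mem m hm n hn =>
      rw [star_mul]
      exact Submodule.mul_mem_mul (hN.star_mem hn) (hM.star_mem hm)
    | add x _ y _ hx hy => simpa using add_mem hx hy
  intro T hT
  simpa using key _ ((hM.mul hN).star_mem hT)

/-- Two isometries with orthogonal ranges on an infinite-dimensional Hilbert space. -/
theorem exists_isometries_orthogonal_ranges (hH : ¬ FiniteDimensional ℂ H) :
    ∃ s t : H →L[ℂ] H, star s * s = 1 ∧ star t * t = 1 ∧ star s * t = 0 := by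
  obtain ⟨w, b, -⟩ := exists_hilbertBasis ℂ H
  have hw : Infinite w := by
    by_contra hfin
    have : Finite w := not_infinite_iff_finite.1 hfin
    have := Fintype.ofFinite w
    exact hH b.toOrthonormalBasis.toBasis.finiteDimensional_of_finite
  have : Nonempty (w ⊕ w ≃ w) := by
    rw [← Cardinal.eq]
    simp
  obtain ⟨σ⟩ := this
  have isom (f : w → w) (hf : f.Injective) :
      ∃ s : H →L[ℂ] H, star s * s = 1 ∧ ∀ i, s (b i) = b (f i) := by
    classical
    let L := (b.orthonormal.comp f hf).orthogonalFamily.linearIsometry.comp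
      b.repr.toLinearIsometry
    refine ⟨L.toContinuousLinearMap, ?_, fun i => ?_⟩
    · rw [ContinuousLinearMap.star_eq_adjoint]
      exact (ContinuousLinearMap.norm_map_iff_adjoint_comp_self _).1 L.norm_map
    · change (b.orthonormal.comp f hf).orthogonalFamily.linearIsometry (b.repr (b i)) = b (f i)
      rw [b.repr_self, OrthogonalFamily.linearIsometry_apply_single]
      simp
  obtain ⟨s, hs, hsb⟩ := isom (σ ∘ Sum.inl) (σ.injective.comp Sum.inl_injective)
  obtain ⟨t, ht, htb⟩ := isom (σ ∘ Sum.inr) (σ.injective.comp Sum.inr_injective)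
  refine ⟨s, t, hs, ht, ?_⟩
  have hdense : Dense (Submodule.span ℂ (Set.range b) : Set H) :=
    Submodule.dense_iff_topologicalClosure_eq_top.2 b.dense_span
  refine ContinuousLinearMap.ext_on hdense ?_
  rintro _ ⟨j, rfl⟩
  refine hdense.eq_of_inner_left (𝕜 := ℂ) ?_
  intro v hv
  induction hv using Submodule.span_induction with
  | mem x hx =>
    obtain ⟨i, rfl⟩ := hx
    have hij : σ (Sum.inr j) ≠ σ (Sum.inl i) := by simp
    simp [ContinuousLinearMap.star_eq_adjoint, ContinuousLinearMap.adjoint_inner_left, hsb, htb,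
      b.orthonormal.inner_eq_zero hij]
  | zero => simp
  | add x y _ _ hx hy => rw [inner_add_right, inner_add_right, hx, hy]
  | smul c x _ hx => rw [inner_smul_right, inner_smul_right, hx]

/-- A ring containing two isometry-like elements with orthogonal ranges has no nonzero
finite-dimensional module. -/
theorem subsingleton_of_finiteDimensional_module {k R M : Type*} [Field k] [Ring R] [Algebra k R]
    [AddCommGroup M] [Module k M] [Module R M] [IsScalarTower k R M] [FiniteDimensional k M]
    {s s' t t' : R} (hs : s' * s = 1) (ht : t' * t = 1) (hst : s' * t = 0) : Subsingleton M := by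
  let π : R →ₐ[k] Module.End k M := Algebra.lsmul k k M
  have hs' : π s * π s' = 1 := by
    rw [mul_eq_one_comm, ← map_mul, hs, map_one]
  have ht0 : π t = 0 := by
    rw [← one_mul (π t), ← hs', mul_assoc, ← map_mul, hst, map_zero, mul_zero]
  have h1 : (1 : Module.End k M) = 0 := by
    rw [← map_one π, ← ht, map_mul, ht0, mul_zero]
  refine ⟨fun x y => ?_⟩
  rw [← Module.End.one_apply (R := k) x, ← Module.End.one_apply (R := k) y, h1]
  rfl

/-- On an infinite-dimensional space, a `B(H)`-ideal cannot exceed another one by a nonzero finite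
dimension. -/
theorem IsBHIdeal.le_of_le_sup_finiteDimensional (hH : ¬ FiniteDimensional ℂ H)
    {V K I : Submodule ℂ (H →L[ℂ] H)} [FiniteDimensional ℂ V]
    (hK : IsBHIdeal (K : Set (H →L[ℂ] H))) (hI : IsBHIdeal (I : Set (H →L[ℂ] H)))
    (h : I ≤ V ⊔ K) : I ≤ K := by
  obtain ⟨s, t, hs, ht, hst⟩ := exists_isometries_orthogonal_ranges hH
  let K' : Submodule (H →L[ℂ] H) (H →L[ℂ] H) :=
    { K with smul_mem' := fun A _ hx => hK.mul_left A hx }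
  let I' : Submodule (H →L[ℂ] H) (H →L[ℂ] H) :=
    { I with smul_mem' := fun A _ hx => hI.mul_left A hx }
  let Q := I'.map K'.mkQ
  have hQ : Q.restrictScalars ℂ ≤ V.map (K'.mkQ.restrictScalars ℂ) := by
    rintro _ ⟨x, hx, rfl⟩
    obtain ⟨v, hv, y, hy, rfl⟩ := Submodule.mem_sup.1 (h hx)
    refine ⟨v, hv, ?_⟩
    have : K'.mkQ y = 0 := (Submodule.Quotient.mk_eq_zero K').2 hy
    simp only [LinearMap.restrictScalars_apply, map_add, this, add_zero]
  have : FiniteDimensional ℂ (Q.restrictScalars ℂ) := Submodule.finiteDimensional_of_le hQ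
  have : FiniteDimensional ℂ Q := this
  have := subsingleton_of_finiteDimensional_module (k := ℂ) (M := Q) hs ht hst
  intro x hx
  have hx0 : (⟨K'.mkQ x, x, hx, rfl⟩ : Q) = 0 := Subsingleton.elim _ _
  exact (Submodule.Quotient.mk_eq_zero K').1 (congrArg Subtype.val hx0)

/-- `B(H)` is simple when `H` is finite-dimensional. -/
theorem IsBHIdeal.eq_bot_or_eq_top [FiniteDimensional ℂ H] {J : Submodule ℂ (H →L[ℂ] H)}
    (hJ : IsBHIdeal (J : Set (H →L[ℂ] H))) : J = ⊥ ∨ J = ⊤ := by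
  refine or_iff_not_imp_left.2 fun hne => ?_
  obtain ⟨A, hA, hA0⟩ := Submodule.exists_mem_ne_zero_of_ne_bot hne
  obtain ⟨x, hx⟩ : ∃ x, A x ≠ 0 := by
    by_contra! h
    exact hA0 (ContinuousLinearMap.ext h)
  have hrank (u v : H) : InnerProductSpace.rankOne ℂ u v ∈ J := by
    have : InnerProductSpace.rankOne ℂ u v = (inner ℂ (A x) (A x))⁻¹ •
        (InnerProductSpace.rankOne ℂ u (A x) * A * InnerProductSpace.rankOne ℂ x v) := by
      ext z
      have : (inner ℂ (A x) (A x)) ≠ 0 := inner_self_ne_zero.2 hx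
      simp only [smul_apply, mul_apply_eq_comp,
        InnerProductSpace.rankOne_apply, map_smul, smul_smul]
      congr 1
      field_simp
    rw [this]
    exact J.smul_mem _ (hJ.mul_right _ (hJ.mul_left _ hA))
  have h1 : (1 : H →L[ℂ] H) ∈ J := by
    rw [ContinuousLinearMap.one_def, ← (stdOrthonormalBasis ℂ H).sum_rankOne_eq_id]
    exact J.sum_mem fun i _ => hrank _ _
  exact eq_top_iff.2 fun T _ => by simpa using hJ.mul_left T h1

theorem mem_closure_mul_range_mul {N : ℕ} {S : Fin N → (H →L[ℂ] H)}
    {P Q : Submodule ℂ (H →L[ℂ] H)} {T : H →L[ℂ] H}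
    (hT : T ∈ P * Submodule.span ℂ (Set.range S) * Q) :
    T ∈ AddSubmonoid.closure {X | ∃ A ∈ P, ∃ B ∈ Q, ∃ k, X = A * S k * B} := by
  induction hT using Submodule.mul_induction_on' with
  | mem_mul_mem x hx b hb =>
    induction hx using Submodule.mul_induction_on' with
    | mem_mul_mem a ha v hv =>
      obtain ⟨c, rfl⟩ := (Submodule.mem_span_range_iff_exists_fun ℂ).1 hv
      rw [Finset.mul_sum, Finset.sum_mul]
      refine sum_mem fun k _ => AddSubmonoid.subset_closure ?_
      exact ⟨c k • a, P.smul_mem _ ha, b, hb, k, by simp⟩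
    | add x _ y _ hx hy =>
      rw [add_mul]
      exact add_mem hx hy
  | add x _ y _ hx hy => exact add_mem hx hy

theorem exists_fin_sum_of_mem_closure {M : Type*} [AddCommMonoid M] {s : Set M} {x : M}
    (hx : x ∈ AddSubmonoid.closure s) :
    ∃ (n : ℕ) (f : Fin n → M), (∀ i, f i ∈ s) ∧ x = ∑ i, f i := by
  obtain ⟨l, hl, rfl⟩ := AddSubmonoid.exists_list_of_mem_closure hx
  refine ⟨l.length, l.get, fun i => hl _ (l.get_mem i), ?_⟩
  rw [← List.sum_ofFn, List.ofFn_get]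

/-- The ideal of `B(H)` generated by a family, as a product of subspaces. -/
def idealSpan {N : ℕ} (S : Fin N → (H →L[ℂ] H)) : Submodule ℂ (H →L[ℂ] H) :=
  ⊤ * Submodule.span ℂ (Set.range S) * ⊤

section idealSpan

variable {N : ℕ} (S : Fin N → (H →L[ℂ] H))

theorem span_le_idealSpan : Submodule.span ℂ (Set.range S) ≤ idealSpan S := fun x hx => by
  have := Submodule.mul_mem_mul (Submodule.mul_mem_mul
    (Submodule.mem_top (x := (1 : H →L[ℂ] H))) hx) (Submodule.mem_top (x := (1 : H →L[ℂ] H)))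
  simpa [idealSpan] using this

theorem isBHIdeal_idealSpan : IsBHIdeal (idealSpan S : Set (H →L[ℂ] H)) := by
  refine IsBHIdeal.of_submodule fun A x hx => ⟨?_, ?_⟩
  · have h := Submodule.mul_mem_mul (Submodule.mem_top (x := A)) hx
    rw [idealSpan, ← mul_assoc, ← mul_assoc] at h
    exact SetLike.le_def.1 (mul_le_mul' (mul_le_mul' le_top le_rfl) le_rfl) h
  · have h := Submodule.mul_mem_mul hx (Submodule.mem_top (x := A))
    rw [idealSpan, mul_assoc] at h
    exact SetLike.le_def.1 (mul_le_mul' le_rfl le_top) h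

variable {S}

theorem idealSpan_le {M : Submodule ℂ (H →L[ℂ] H)} (hM : IsBHIdeal (M : Set (H →L[ℂ] H)))
    (h : ∀ j, S j ∈ M) : idealSpan S ≤ M := by
  refine Submodule.mul_le.2 fun x hx b _ => hM.mul_right b ?_
  have : ⊤ * Submodule.span ℂ (Set.range S) ≤ M :=
    Submodule.mul_le.2 fun a _ v hv => hM.mul_left a
      (Submodule.span_le.2 (Set.range_subset_iff.2 h) hv)
  exact this hx

theorem genBH_eq_idealSpan : genBH (Set.range S) = idealSpan S := by
  refine Set.Subset.antisymm ?_ ?_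
  · exact Set.sInter_subset_of_mem ⟨isBHIdeal_idealSpan S,
      Submodule.subset_span.trans (span_le_idealSpan S)⟩
  · refine Set.subset_sInter fun I hI => ?_
    exact idealSpan_le (M := hI.1.toSubmodule) hI.1 fun j => hI.2 ⟨j, rfl⟩

theorem JGen_eq_mul {J : Submodule ℂ (H →L[ℂ] H)} :
    JGen (J : Set (H →L[ℂ] H)) (Set.range S) = (J * idealSpan S : Submodule ℂ (H →L[ℂ] H)) := by
  ext T
  simp only [JGen, genBH_eq_idealSpan, Set.mem_ofPred_eq, SetLike.mem_coe]
  constructor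
  · rintro ⟨n, A, X, h, rfl⟩
    exact sum_mem fun i _ => Submodule.mul_mem_mul (h i).1 (h i).2
  · intro hT
    have hT' : T ∈ AddSubmonoid.closure {Y | ∃ A ∈ J, ∃ X ∈ idealSpan S, Y = A * X} := by
      induction hT using Submodule.mul_induction_on' with
      | mem_mul_mem a ha x hx => exact AddSubmonoid.subset_closure ⟨a, ha, x, hx, rfl⟩
      | add x _ y _ hx hy => exact add_mem hx hy
    obtain ⟨n, f, hf, rfl⟩ := exists_fin_sum_of_mem_closure hT'
    choose A hA X hX h using hf
    exact ⟨n, A, X, fun i => ⟨hA i, hX i⟩, by simp [h]⟩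

/-- A `B(H)`-ideal that is `J`-soft on one side is so on both sides. -/
theorem idealSpan_le_mul_span_mul {J : Submodule ℂ (H →L[ℂ] H)}
    (hJ : IsBHIdeal (J : Set (H →L[ℂ] H))) (h : idealSpan S ≤ J * idealSpan S) :
    idealSpan S ≤ J * Submodule.span ℂ (Set.range S) * J := by
  have hJl : J * ⊤ ≤ J := Submodule.mul_le.2 fun x hx A _ => hJ.mul_right A hx
  have hJr : ⊤ * J ≤ J := Submodule.mul_le.2 fun A _ x hx => hJ.mul_left A hx
  calc idealSpan S ≤ J * idealSpan S := h
    _ ≤ J * (idealSpan S * J) :=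
      mul_le_mul' le_rfl (h.trans (hJ.mul_le_mul_swap (isBHIdeal_idealSpan S)))
    _ = (J * ⊤) * Submodule.span ℂ (Set.range S) * (⊤ * J) := by
      simp only [idealSpan, mul_assoc]
    _ ≤ J * Submodule.span ℂ (Set.range S) * J := mul_le_mul' (mul_le_mul' hJl le_rfl) hJr

/-- If the linear `J`-ideal generated by `S` is a `B(H)`-ideal, then `(S)` is `J`-soft. -/
theorem idealSpan_le_mul_of_subset_genLin {J : Submodule ℂ (H →L[ℂ] H)}
    (hJ : IsBHIdeal (J : Set (H →L[ℂ] H))) (hS : ∀ j, S j ∈ J)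
    (h : (idealSpan S : Set (H →L[ℂ] H)) ⊆ genLin (J : Set (H →L[ℂ] H)) (Set.range S)) :
    idealSpan S ≤ J * idealSpan S := by
  have hI := isBHIdeal_idealSpan S
  have hIJ : idealSpan S ≤ J := idealSpan_le hJ hS
  by_cases hH : FiniteDimensional ℂ H
  · rcases hJ.eq_bot_or_eq_top with rfl | rfl
    · exact hIJ.trans bot_le
    · exact fun x hx => by simpa using Submodule.mul_mem_mul (Submodule.mem_top (x := 1)) hx
  let V := Submodule.span ℂ (Set.range S)
  have hV : V ≤ idealSpan S := span_le_idealSpan S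
  let K := J * idealSpan S ⊔ idealSpan S * J
  have hK : IsBHIdeal (K : Set (H →L[ℂ] H)) := (hJ.mul hI).sup (hI.mul hJ)
  have hKJ : K ≤ J := sup_le (Submodule.mul_le.2 fun x hx A _ => hJ.mul_right A hx)
    (Submodule.mul_le.2 fun A _ x hx => hJ.mul_left A hx)
  have hVK : IsLinearSubideal (J : Set (H →L[ℂ] H)) (V ⊔ K : Submodule ℂ (H →L[ℂ] H)) := by
    refine ⟨⟨sup_le (hV.trans hIJ) hKJ, zero_mem _, fun _ hx _ hy => add_mem hx hy,
      fun _ hx => neg_mem hx, fun A hA x hx => ?_⟩, fun c _ hx => Submodule.smul_mem _ c hx⟩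
    obtain ⟨v, hv, y, hy, rfl⟩ := Submodule.mem_sup.1 hx
    rw [mul_add, add_mul]
    have hl : A * v ∈ K := Submodule.mem_sup_left (Submodule.mul_mem_mul hA (hV hv))
    have hr : v * A ∈ K := Submodule.mem_sup_right (Submodule.mul_mem_mul (hV hv) hA)
    exact ⟨Submodule.mem_sup_right (add_mem hl (hK.mul_left A hy)),
      Submodule.mem_sup_right (add_mem hr (hK.mul_right A hy))⟩
  have hle : idealSpan S ≤ V ⊔ K := h.trans
    (Set.sInter_subset_of_mem ⟨hVK, fun _ hx => Submodule.mem_sup_left (Submodule.subset_span hx)⟩)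
  have : FiniteDimensional ℂ V := FiniteDimensional.span_of_finite ℂ (Set.finite_range S)
  exact (hK.le_of_le_sup_finiteDimensional hH hI hle).trans
    (sup_le le_rfl (hI.mul_le_mul_swap hJ))

end idealSpan

theorem genSub_subset_genReal (J 𝒮 : Set (H →L[ℂ] H)) : genSub J 𝒮 ⊆ genReal J 𝒮 :=
  Set.sInter_subset_sInter fun _ hI => ⟨hI.1.1, hI.2⟩

theorem genReal_subset_genLin (J 𝒮 : Set (H →L[ℂ] H)) : genReal J 𝒮 ⊆ genLin J 𝒮 :=
  Set.sInter_subset_sInter fun _ hI =>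
    ⟨⟨hI.1.1, fun r x hx => by simpa using hI.1.2 (r : ℂ) x hx⟩, hI.2⟩

theorem isBHIdeal_genBH (𝒮 : Set (H →L[ℂ] H)) : IsBHIdeal (genBH 𝒮) :=
  ⟨fun _ hI => hI.1.1, fun x hx y hy I hI => hI.1.2.1 x (hx I hI) y (hy I hI),
    fun x hx I hI => hI.1.2.2.1 x (hx I hI), fun A _ hx =>
      ⟨fun I hI => hI.1.mul_left A (hx I hI), fun I hI => hI.1.mul_right A (hx I hI)⟩⟩

theorem subset_genSub (J 𝒮 : Set (H →L[ℂ] H)) : 𝒮 ⊆ genSub J 𝒮 :=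
  Set.subset_sInter fun _ hI => hI.2

theorem genLin_subset_genBH {J 𝒮 : Set (H →L[ℂ] H)} (hJ : IsBHIdeal J) (h : 𝒮 ⊆ J) :
    genLin J 𝒮 ⊆ genBH 𝒮 := by
  have hI := isBHIdeal_genBH 𝒮
  exact Set.sInter_subset_of_mem ⟨⟨⟨Set.sInter_subset_of_mem ⟨hJ, h⟩, hI.1, hI.2.1, hI.2.2.1,
    fun A _ x hx => hI.2.2.2 A x hx⟩, fun c _ hx => hI.toSubmodule.smul_mem c hx⟩,
    Set.subset_sInter fun _ hI => hI.2⟩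

theorem genBH_subset_genSub {J : Set (H →L[ℂ] H)} (hJ : IsBHIdeal J) {N : ℕ}
    {S : Fin N → (H →L[ℂ] H)}
    (h : ∀ j, ∃ (m : ℕ) (A B : Fin m → (H →L[ℂ] H)) (k : Fin m → Fin N),
      (∀ i, A i ∈ J ∧ B i ∈ J) ∧ S j = ∑ i, A i * S (k i) * B i) :
    genBH (Set.range S) ⊆ genSub J (Set.range S) := by
  rw [genBH_eq_idealSpan]
  refine Set.subset_sInter fun I hI T hT => ?_
  obtain ⟨⟨-, h0, hadd, -, hmul⟩, hSI⟩ := hI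
  let I' : AddSubmonoid (H →L[ℂ] H) := ⟨⟨I, fun {x y} hx hy => hadd x hx y hy⟩, h0⟩
  refine (AddSubmonoid.closure_le (S := I')).2 ?_ (mem_closure_mul_range_mul hT)
  rintro _ ⟨C, -, D, -, j, rfl⟩
  obtain ⟨m, A, B, k, hAB, hj⟩ := h j
  rw [hj, Finset.mul_sum, Finset.sum_mul]
  refine I'.sum_mem fun i _ => ?_
  have : C * (A i * S (k i) * B i) * D = C * A i * S (k i) * (B i * D) := by
    simp only [mul_assoc]
  rw [this]
  exact (hmul _ (hJ.mul_right D (hAB i).2) _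
    (hmul _ (hJ.mul_left C (hAB i).1) _ (hSI ⟨k i, rfl⟩)).1).2

/-- equivalent conditions for a finitely generated `J`-ideal to be a
`B(H)`-ideal; when these hold all three coincide with `(𝒮)`. -/
theorem stmt_18 (J : Set (H →L[ℂ] H)) (hJ : IsBHIdeal J)
    (N : ℕ) (S : Fin N → (H →L[ℂ] H)) (hS : ∀ j, S j ∈ J) :
    ((IsBHIdeal (genLin J (Set.range S)) ↔ IsBHIdeal (genSub J (Set.range S))) ∧
     (IsBHIdeal (genLin J (Set.range S)) ↔ IsBHIdeal (genReal J (Set.range S))) ∧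
     (IsBHIdeal (genLin J (Set.range S)) ↔
        genBH (Set.range S) = JGen J (Set.range S)) ∧
     (IsBHIdeal (genLin J (Set.range S)) ↔
        ∀ j, ∃ (m : ℕ) (A B : Fin m → (H →L[ℂ] H)) (k : Fin m → Fin N),
          (∀ i, A i ∈ J ∧ B i ∈ J) ∧ S j = ∑ i, A i * S (k i) * B i)) ∧
    (IsBHIdeal (genLin J (Set.range S)) →
      genSub J (Set.range S) = genBH (Set.range S) ∧
      genReal J (Set.range S) = genBH (Set.range S) ∧
      genLin J (Set.range S) = genBH (Set.range S)) := by
  have hSJ : Set.range S ⊆ J := Set.range_subset_iff.2 hS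
  have h₁ := genSub_subset_genReal J (Set.range S)
  have h₂ := genReal_subset_genLin J (Set.range S)
  have h₃ := genLin_subset_genBH hJ hSJ
  have hBH := isBHIdeal_genBH (Set.range S)
  have hS₁ := subset_genSub J (Set.range S)
  have eqs (h : genBH (Set.range S) ⊆ genSub J (Set.range S)) :
      genSub J (Set.range S) = genBH (Set.range S) ∧
      genReal J (Set.range S) = genBH (Set.range S) ∧
      genLin J (Set.range S) = genBH (Set.range S) :=
    ⟨(h₁.trans (h₂.trans h₃)).antisymm h, (h₂.trans h₃).antisymm (h.trans h₁),
      h₃.antisymm (h.trans (h₁.trans h₂))⟩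
  have lin_soft (h : IsBHIdeal (genLin J (Set.range S))) :
      genBH (Set.range S) = JGen J (Set.range S) := by
    have hle : genBH (Set.range S) ⊆ genLin J (Set.range S) :=
      Set.sInter_subset_of_mem ⟨h, hS₁.trans (h₁.trans h₂)⟩
    rw [genBH_eq_idealSpan] at hle ⊢
    refine Set.Subset.antisymm ?_ ?_
    · rw [show J = (hJ.toSubmodule : Set (H →L[ℂ] H)) from rfl, JGen_eq_mul]
      exact idealSpan_le_mul_of_subset_genLin (J := hJ.toSubmodule) hJ hS hle
    · rw [show J = (hJ.toSubmodule : Set (H →L[ℂ] H)) from rfl, JGen_eq_mul]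
      exact Submodule.mul_le.2 fun A _ x hx => (isBHIdeal_idealSpan S).mul_left A hx
  have soft_sum (h : genBH (Set.range S) = JGen J (Set.range S)) :
      ∀ j, ∃ (m : ℕ) (A B : Fin m → (H →L[ℂ] H)) (k : Fin m → Fin N),
        (∀ i, A i ∈ J ∧ B i ∈ J) ∧ S j = ∑ i, A i * S (k i) * B i := by
    intro j
    rw [show J = (hJ.toSubmodule : Set (H →L[ℂ] H)) from rfl, JGen_eq_mul,
      genBH_eq_idealSpan] at h
    have hj := idealSpan_le_mul_span_mul (J := hJ.toSubmodule) hJ h.le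
      (span_le_idealSpan S (Submodule.subset_span ⟨j, rfl⟩))
    obtain ⟨n, f, hf, hsum⟩ := exists_fin_sum_of_mem_closure (mem_closure_mul_range_mul hj)
    choose A hA B hB k hk using hf
    exact ⟨n, A, B, k, fun i => ⟨hA i, hB i⟩, by simp [hsum, hk]⟩
  have lin_sub (h : IsBHIdeal (genLin J (Set.range S))) :=
    genBH_subset_genSub hJ (soft_sum (lin_soft h))
  have sub_lin (h : genBH (Set.range S) ⊆ genSub J (Set.range S)) :
      IsBHIdeal (genLin J (Set.range S)) := by
    rw [(eqs h).2.2]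
    exact hBH
  refine ⟨⟨⟨fun h => ?_, fun h => ?_⟩, ⟨fun h => ?_, fun h => ?_⟩,
    ⟨lin_soft, fun h => sub_lin (genBH_subset_genSub hJ (soft_sum h))⟩,
    ⟨fun h => soft_sum (lin_soft h), fun h => sub_lin (genBH_subset_genSub hJ h)⟩⟩,
    fun h => eqs (lin_sub h)⟩
  · rw [(eqs (lin_sub h)).1]
    exact hBH
  · exact sub_lin (Set.sInter_subset_of_mem ⟨h, hS₁⟩)
  · rw [(eqs (lin_sub h)).2.1]
    exact hBH
  · have hle : genBH (Set.range S) ⊆ genReal J (Set.range S) :=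
      Set.sInter_subset_of_mem ⟨h, hS₁.trans h₁⟩
    rw [h₃.antisymm (hle.trans h₂)]
    exact hBH
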